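/- (Loop Hafnian master theorem, trace-formula form.) Let M ≥ 1, let A ∈ ℂ^{2M×2M} be symmetric, let γ ∈ ℂ^{2M}, let z ∈ ℂ^M, and let N ∈ ℕ. Then Σ_{n ∈ ℕ^M, n_1+⋯+n_M = N} lhaf(A_{n⊕n}, γ_{n⊕n}) · Π_{i=1}^M z_i^{n_i}/n_i! = f_N(A, γ, z). -/

import Mathlib

open Matrix

noncomputable section

/-- The loop Hafnian of a matrix `B`: the sum over all involutions `σ` of `{0,…,d-1}`
of the product over `i ≤ σ i` of `B i (σ i)`. -/
def lhaf {d : ℕ} (B : Matrix (Fin d) (Fin d) ℂ) : ℂ :=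
  ∑ σ ∈ Finset.univ.filter (fun σ : Equiv.Perm (Fin d) => σ * σ = 1),
    ∏ i ∈ Finset.univ.filter (fun i => i ≤ σ i), B i (σ i)

/-- `filldiag A γ` is `A` with its diagonal overwritten by the entries of `γ`. -/
def filldiag {d : ℕ} (A : Matrix (Fin d) (Fin d) ℂ) (γ : Fin d → ℂ) :
    Matrix (Fin d) (Fin d) ℂ :=
  Matrix.of fun i j => if i = j then γ i else A i j

/-- `lhaf(A, γ) := lhaf(filldiag(A, γ))`. -/
def lhafv {d : ℕ} (A : Matrix (Fin d) (Fin d) ℂ) (γ : Fin d → ℂ) : ℂ :=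
  lhaf (filldiag A γ)

/-- The list containing `n k` consecutive copies of `k`, for `k = 0, 1, …, M-1` in order. -/
def repList {M : ℕ} (n : Fin M → ℕ) : List (Fin M) :=
  (List.finRange M).flatMap fun k => List.replicate (n k) k

lemma repList_length {M : ℕ} (n : Fin M → ℕ) : (repList n).length = ∑ k, n k := by
  simp only [repList, List.length_flatMap, Fin.sum_univ_def, List.map_map]
  congr 1
  simp [Function.comp]

/-- The repetition map sending each of the `∑ k, n k` indices to the original index of
which it is a copy (`n k` copies of `k`, in order). -/
def rep {M : ℕ} (n : Fin M → ℕ) (i : Fin (∑ k, n k)) : Fin M :=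
  (repList n).get (Fin.cast (repList_length n).symm i)

/-- The doubled repetition map: the first `∑ k, n k` indices are copies of the "left"
indices (`n k` copies of `inl k`), the last `∑ k, m k` are copies of the "right" indices
(`m k` copies of `inr k`). -/
def dbl {M : ℕ} (n m : Fin M → ℕ) :
    Fin ((∑ k, n k) + (∑ k, m k)) → Fin M ⊕ Fin M :=
  (Sum.map (rep n) (rep m)) ∘ finSumFinEquiv.symm

/-- `A_{n⊕m}`: the matrix obtained from a `2M × 2M` matrix `A` (indexed by
`Fin M ⊕ Fin M`) by taking `n k` copies of the `k`-th row/column and `m k` copies of the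
`(M+k)`-th row/column. -/
def repMat {M : ℕ} (A : Matrix (Fin M ⊕ Fin M) (Fin M ⊕ Fin M) ℂ) (n m : Fin M → ℕ) :
    Matrix (Fin ((∑ k, n k) + (∑ k, m k))) (Fin ((∑ k, n k) + (∑ k, m k))) ℂ :=
  A.submatrix (dbl n m) (dbl n m)

/-- `γ_{n⊕m}`: the vector obtained from `γ` by taking `n k` copies of the `k`-th entry and
`m k` copies of the `(M+k)`-th entry. -/
def repVec {M : ℕ} (γ : Fin M ⊕ Fin M → ℂ) (n m : Fin M → ℕ) :
    Fin ((∑ k, n k) + (∑ k, m k)) → ℂ :=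
  γ ∘ dbl n m

/-- The swap matrix `X = [[0, I],[I, 0]]`. -/
def Xmat (ι : Type*) [DecidableEq ι] [Fintype ι] (R : Type*) [CommRing R] :
    Matrix (ι ⊕ ι) (ι ⊕ ι) R :=
  Matrix.fromBlocks 0 1 1 0

/-- `D(z) = diag(z) ⊕ diag(z)`. -/
def Dmat {ι : Type*} [DecidableEq ι] {R : Type*} [CommRing R] (z : ι → R) :
    Matrix (ι ⊕ ι) (ι ⊕ ι) R :=
  Matrix.diagonal (Sum.elim z z)

/-- `g_k(A,γ,z) = tr((D(z)XA)^k)/(2k) + (1/2)·γᵀ (D(z)XA)^{k-1} D(z)X γ`. -/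
def gfun {ι : Type*} [Fintype ι] [DecidableEq ι] {R : Type*} [CommRing R]
    (A : Matrix (ι ⊕ ι) (ι ⊕ ι) R) (γ : ι ⊕ ι → R) (z : ι → R) (k : ℕ) : R :=
  Ring.inverse ((2 * k : ℕ) : R) * Matrix.trace ((Dmat z * Xmat ι R * A) ^ k)
    + Ring.inverse (2 : R) *
        (γ ⬝ᵥ Matrix.mulVec ((Dmat z * Xmat ι R * A) ^ (k - 1) * (Dmat z * Xmat ι R)) γ)

/-- `f_N(A,γ,z)`: the coefficient of `η^N` in `Σ_{j=0}^N (1/j!)(Σ_{k=1}^N g_k(A,γ,z) η^k)^j`. -/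
def fN {ι : Type*} [Fintype ι] [DecidableEq ι] {R : Type*} [CommRing R]
    (N : ℕ) (A : Matrix (ι ⊕ ι) (ι ⊕ ι) R) (γ : ι ⊕ ι → R) (z : ι → R) : R :=
  Polynomial.coeff
    (∑ j ∈ Finset.range (N + 1),
      Polynomial.C (Ring.inverse ((j.factorial : ℕ) : R)) *
        (∑ k ∈ Finset.Icc 1 N, Polynomial.C (gfun A γ z k) * Polynomial.X ^ k) ^ j) N

section ListPart
variable {ι : Type*} {R : Type*} [CommRing R]

/-- `rm v F w = ∑ i, v (w i) * F (w without i)`. -/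
def rmv (v : ι → R) : (List ι → R) → List ι → R
  | _, [] => 0
  | F, a :: w => v a * F w + rmv v (fun u => F (a :: u)) w

lemma rmv_nil (v : ι → R) (F : List ι → R) : rmv v F [] = 0 := rfl

lemma rmv_cons (v : ι → R) (F : List ι → R) (a : ι) (w : List ι) :
    rmv v F (a :: w) = v a * F w + rmv v (fun u => F (a :: u)) w := rfl

lemma rmv_add (v : ι → R) (F G : List ι → R) (w : List ι) :
    rmv v (fun u => F u + G u) w = rmv v F w + rmv v G w := by
  induction w generalizing F G with
  | nil => simp [rmv_nil]
  | cons a w ih => simp only [rmv_cons, ih]; ring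

lemma rmv_smul (v : ι → R) (c : R) (F : List ι → R) (w : List ι) :
    rmv v (fun u => c * F u) w = c * rmv v F w := by
  induction w generalizing F with
  | nil => simp [rmv_nil]
  | cons a w ih => simp only [rmv_cons, ih]; ring

lemma rmv_zero (v : ι → R) (w : List ι) :
    rmv v (fun _ => 0) w = 0 := by
  induction w with
  | nil => simp [rmv_nil]
  | cons a w ih => simp only [rmv_cons, ih]; ring

lemma rmv_sum {κ : Type*} (s : Finset κ) (v : ι → R) (F : κ → List ι → R) (w : List ι) :
    rmv v (fun u => ∑ k ∈ s, F k u) w = ∑ k ∈ s, rmv v (F k) w := by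
  classical
  induction s using Finset.induction_on with
  | empty => simp [rmv_zero]
  | insert a s ha ih => simp only [Finset.sum_insert ha, rmv_add, ih]

lemma rmv_vsum {κ : Type*} (s : Finset κ) (c : κ → R) (v : κ → ι → R) (F : List ι → R)
    (w : List ι) :
    rmv (fun a => ∑ k ∈ s, c k * v k a) F w = ∑ k ∈ s, c k * rmv (v k) F w := by
  induction w generalizing F with
  | nil => simp [rmv_nil]
  | cons a w ih => 
    simp only [rmv_cons, ih, Finset.sum_mul, ← Finset.sum_add_distrib]
    exact Finset.sum_congr rfl fun k _ => by ring

lemma rmv_comm (u v : ι → R) (F : List ι → R) (w : List ι) :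
    rmv u (rmv v F) w = rmv v (rmv u F) w := by
  induction w generalizing F with
  | nil => simp [rmv_nil]
  | cons a w ih =>
    have h : ∀ (x : ι → R), (fun t => rmv x F (a :: t)) =
        fun t => x a * F t + rmv x (fun s => F (a :: s)) t := fun x => rfl
    rw [rmv_cons, rmv_cons, h, h, rmv_add, rmv_add, rmv_smul, rmv_smul, ih]
    ring

lemma rmv_congr (v : ι → R) (F G : List ι → R) (w : List ι)
    (h : ∀ u : List ι, u.length + 1 = w.length → F u = G u) : rmv v F w = rmv v G w := by
  induction w generalizing F G with
  | nil => rfl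
  | cons a w ih =>
    rw [rmv_cons, rmv_cons, h w (by simp)]
    congr 1
    apply ih
    intro u hu
    exact h _ (by simp [hu])

lemma rmv_perm (v : ι → R) (F : List ι → R) (hF : ∀ u u', u.Perm u' → F u = F u')
    {w w' : List ι} (h : w.Perm w') : rmv v F w = rmv v F w' := by
  induction h generalizing F with
  | nil => rfl
  | cons a h ih =>
    rw [rmv_cons, rmv_cons, hF _ _ h, ih]
    exact fun u u' h' => hF _ _ (h'.cons a)
  | swap a b l =>
    simp only [rmv_cons]
    have : (fun u => F (a :: b :: u)) = fun u => F (b :: a :: u) :=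
      funext fun u => hF _ _ (List.Perm.swap _ _ _)
    rw [this]; ring
  | trans _ _ ih1 ih2 => rw [ih1 F hF, ih2 F hF]

lemma rmv_eq_sum (v : ι → R) (F : List ι → R) (w : List ι) :
    rmv v F w = ∑ i : Fin w.length, v (w.get i) * F (w.eraseIdx i) := by
  induction w generalizing F with
  | nil => simp [rmv_nil]
  | cons a w ih =>
    rw [rmv_cons, ih]
    simp [Fin.sum_univ_succ]

/-- fuel version -/
def LF (A : ι → ι → R) (γ : ι → R) : ℕ → List ι → R
  | _, [] => 1
  | 0, _ :: _ => 0
  | n + 1, a :: w => γ a * LF A γ n w + rmv (A a) (LF A γ n) w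

lemma LF_nil (A : ι → ι → R) (γ : ι → R) (n : ℕ) : LF A γ n [] = 1 := by
  cases n <;> rfl

lemma LF_cons (A : ι → ι → R) (γ : ι → R) (n : ℕ) (a : ι) (w : List ι) :
    LF A γ (n+1) (a :: w) = γ a * LF A γ n w + rmv (A a) (LF A γ n) w := rfl

lemma LF_stable (A : ι → ι → R) (γ : ι → R) (n m : ℕ) (w : List ι) (hn : w.length ≤ n)
    (hm : w.length ≤ m) : LF A γ n w = LF A γ m w := by
  induction n generalizing m w with
  | zero =>
    have : w = [] := by simpa using hn
    subst this; simp [LF_nil]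
  | succ n ih =>
    cases w with
    | nil => simp [LF_nil]
    | cons a w =>
      cases m with
      | zero => simp at hm
      | succ m =>
        simp only [List.length_cons, add_le_add_iff_right] at hn hm
        rw [LF_cons, LF_cons, ih m w hn hm]
        congr 1
        exact rmv_congr _ _ _ _ fun u hu => ih m u (by omega) (by omega)

/-- loop hafnian on words -/
def LL (A : ι → ι → R) (γ : ι → R) (w : List ι) : R := LF A γ w.length w

lemma LL_nil (A : ι → ι → R) (γ : ι → R) : LL A γ [] = 1 := rfl

lemma LL_cons (A : ι → ι → R) (γ : ι → R) (a : ι) (w : List ι) :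
    LL A γ (a :: w) = γ a * LL A γ w + rmv (A a) (LL A γ) w := by
  unfold LL
  rw [List.length_cons, LF_cons]
  congr 1
  exact rmv_congr _ _ _ _ fun u hu => LF_stable _ _ _ _ _ (by omega) le_rfl

lemma LF_perm (A : ι → ι → R) (hA : ∀ a b, A a b = A b a) (γ : ι → R) (n : ℕ) {w w' : List ι}
    (h : w.Perm w') : LF A γ n w = LF A γ n w' := by
  induction n using Nat.strong_induction_on generalizing w w' with
  | _ n ihn =>
  induction h with
  | nil => rfl
  | cons a h ih =>
    cases n with
    | zero => rfl
    | succ n =>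
      rw [LF_cons, LF_cons, ihn n (by omega) h, rmv_perm _ _ _ h]
      exact fun u u' h => ihn n (by omega) h
  | swap a b l =>
    match n with
    | 0 => rfl
    | 1 =>
      have h0 : ∀ x : ι, (fun u => LF A γ 0 (x :: u)) = fun _ => 0 := fun x => rfl
      have h1 : ∀ x : ι, LF A γ 0 (x :: l) = 0 := fun x => rfl
      simp only [LF_cons, rmv_cons, h0, h1, rmv_zero, hA a b]
      ring
    | n + 2 =>
      simp only [LF_cons A γ (n+1), rmv_cons, LF_cons A γ n, rmv_add, rmv_smul]
      rw [hA a b, rmv_comm (A a) (A b)]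
      ring
  | trans _ _ ih1 ih2 => rw [ih1, ih2]

lemma LL_perm (A : ι → ι → R) (hA : ∀ a b, A a b = A b a) (γ : ι → R) {w w' : List ι}
    (h : w.Perm w') : LL A γ w = LL A γ w' := by
  unfold LL
  rw [h.length_eq, LF_perm A hA γ _ h]

lemma map_rmv {R' : Type*} [CommRing R'] (f : R →+* R') (v : ι → R) (F : List ι → R)
    (w : List ι) : f (rmv v F w) = rmv (fun a => f (v a)) (fun u => f (F u)) w := by
  induction w generalizing F with
  | nil => simp [rmv_nil]
  | cons a w ih => simp [rmv_cons, ih]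

lemma map_LL {R' : Type*} [CommRing R'] (f : R →+* R') (A : ι → ι → R) (γ : ι → R) 
    (w : List ι) : f (LL A γ w) = LL (fun a b => f (A a b)) (fun a => f (γ a)) w := by
  induction h : w.length using Nat.strong_induction_on generalizing w with
  | _ n ih =>
  cases w with
  | nil => simp [LL_nil]
  | cons a w =>
    simp only [List.length_cons] at h
    rw [LL_cons, LL_cons, map_add, map_mul, map_rmv, ih w.length (by omega) w rfl]
    congr 1
    exact rmv_congr _ _ _ _ fun u hu => ih u.length (by omega) u rfl

lemma D_rmv {K : Type*} [CommRing K] [Algebra K R] (D : Derivation K R R) (v : ι → R)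
    (F : List ι → R) (w : List ι) :
    D (rmv v F w) = rmv (fun a => D (v a)) F w + rmv v (fun u => D (F u)) w := by
  induction w generalizing F with
  | nil => simp [rmv_nil]
  | cons a w ih => simp only [rmv_cons, map_add, ih, Derivation.leibniz, smul_eq_mul]; ring

/-- twice the derivative operator -/
def TT [Fintype ι] (S A : ι → ι → R) (γ : ι → R) (F : List ι → R) (w : List ι) : R :=
  ∑ a, ∑ b, S a b * (γ a * rmv (A b) F w + γ b * rmv (A a) F w + rmv (A a) (rmv (A b) F) w)

lemma D_LL [Fintype ι] {K : Type*} [CommRing K] [Algebra K R] (D : Derivation K R R)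
    (S A : ι → ι → R) (γ : ι → R) (hA : ∀ a b, A a b = A b a) (hS : ∀ a b, S a b = S b a)
    (hDγ : ∀ c, D (γ c) = ∑ a, ∑ b, S a b * (A c a * γ b))
    (hDA : ∀ c d, D (A c d) = ∑ a, ∑ b, S a b * (A c a * A b d)) (w : List ι) :
    2 * D (LL A γ w) = TT S A γ (LL A γ) w := by
  induction h : w.length using Nat.strong_induction_on generalizing w with
  | _ n ih =>
  cases w with
  | nil => simp [LL_nil, TT, rmv_nil]
  | cons c w =>
    simp only [List.length_cons] at h
    have hw := ih w.length (by omega) w rfl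
    have e1 : 2 * D (LL A γ (c :: w)) = 2 * (D (γ c) * LL A γ w)
        + γ c * TT S A γ (LL A γ) w + 2 * rmv (fun d => D (A c d)) (LL A γ) w
        + rmv (A c) (TT S A γ (LL A γ)) w := by
      have h3 : rmv (A c) (TT S A γ (LL A γ)) w = rmv (A c) (fun u => 2 * D (LL A γ u)) w :=
        rmv_congr _ _ _ _ fun u hu => (ih u.length (by omega) u rfl).symm
      rw [LL_cons, map_add, D_rmv, Derivation.leibniz, h3, rmv_smul, ← hw]
      simp only [smul_eq_mul]; ring
    have e2 : 2 * D (γ c) = ∑ a, ∑ b, S a b * (A c a * γ b + A c b * γ a) := by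
      rw [two_mul, hDγ]
      nth_rewrite 2 [Finset.sum_comm]
      simp only [← Finset.sum_add_distrib]
      refine Finset.sum_congr rfl fun a _ => Finset.sum_congr rfl fun b _ => ?_
      rw [hS b a]; ring
    have e3 : 2 * rmv (fun d => D (A c d)) (LL A γ) w =
        ∑ a, ∑ b, S a b * (A c a * rmv (A b) (LL A γ) w + A c b * rmv (A a) (LL A γ) w) := by
      have : (fun d => D (A c d)) = fun d => ∑ p : ι × ι, (S p.1 p.2 * A c p.1) * A p.2 d := by
        funext d
        rw [hDA, ← Fintype.sum_prod_type']
        exact Finset.sum_congr rfl fun p _ => by ring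
      rw [this, rmv_vsum, Fintype.sum_prod_type, two_mul]
      nth_rewrite 2 [Finset.sum_comm]
      simp only [← Finset.sum_add_distrib]
      refine Finset.sum_congr rfl fun a _ => Finset.sum_congr rfl fun b _ => ?_
      rw [hS b a]; ring
    have e4 : rmv (A c) (TT S A γ (LL A γ)) w = ∑ a, ∑ b, S a b *
        (γ a * rmv (A b) (rmv (A c) (LL A γ)) w + γ b * rmv (A a) (rmv (A c) (LL A γ)) w
          + rmv (A a) (rmv (A b) (rmv (A c) (LL A γ))) w) := by
      have hT : TT S A γ (LL A γ) = fun u => ∑ a, ∑ b, S a b * (γ a * rmv (A b) (LL A γ) u + γ b * rmv (A a) (LL A γ) u + rmv (A a) (rmv (A b) (LL A γ)) u) := rfl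
      rw [hT, rmv_sum]
      refine Finset.sum_congr rfl fun a _ => ?_
      rw [rmv_sum]
      refine Finset.sum_congr rfl fun b _ => ?_
      rw [rmv_smul, rmv_add, rmv_add, rmv_smul, rmv_smul, rmv_comm (A c) (A b),
        rmv_comm (A c) (A a), rmv_comm (A c) (A a)]
      have : rmv (A c) (rmv (A b) (LL A γ)) = rmv (A b) (rmv (A c) (LL A γ)) :=
        funext fun u => rmv_comm _ _ _ _
      rw [this]
    have hL : (fun u => LL A γ (c :: u)) = fun u => γ c * LL A γ u + rmv (A c) (LL A γ) u :=
      funext fun u => LL_cons _ _ _ _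
    rw [e1, ← mul_assoc, e2, e3, e4]
    simp only [TT]
    rw [Finset.sum_mul, Finset.mul_sum, ← Finset.sum_add_distrib, ← Finset.sum_add_distrib,
      ← Finset.sum_add_distrib]
    refine Finset.sum_congr rfl fun a _ => ?_
    rw [Finset.sum_mul, Finset.mul_sum, ← Finset.sum_add_distrib, ← Finset.sum_add_distrib,
      ← Finset.sum_add_distrib]
    refine Finset.sum_congr rfl fun b _ => ?_
    simp only [rmv_cons, hL, rmv_add, rmv_smul]
    rw [hA c a, hA c b]
    ring

lemma TT_LL [Fintype ι] (S A : ι → ι → R) (γ : ι → R) (w : List ι) :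
    TT S A γ (LL A γ) w + (∑ a, ∑ b, S a b * (A a b + γ a * γ b)) * LL A γ w =
      ∑ a, ∑ b, S a b * LL A γ (a :: b :: w) := by
  have hL : ∀ c, (fun u => LL A γ (c :: u)) = fun u => γ c * LL A γ u + rmv (A c) (LL A γ) u :=
    fun c => funext fun u => LL_cons _ _ _ _
  simp only [TT, Finset.sum_mul, ← Finset.sum_add_distrib]
  refine Finset.sum_congr rfl fun a _ => Finset.sum_congr rfl fun b _ => ?_
  rw [LL_cons, LL_cons, rmv_cons, hL, rmv_add, rmv_smul]
  ring

end ListPart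
section LhafPart

lemma lhaf_fiber {m n : ℕ} (B : Matrix (Fin n) (Fin n) ℂ) (e : Fin m ↪o Fin n)
    (ρ : Equiv.Perm (Fin n)) (hρ : ∀ x, ρ (ρ x) = x) (hρe : ∀ i, ρ (e i) = e i) :
    ∑ σ ∈ Finset.univ.filter (fun σ : Equiv.Perm (Fin n) => σ * σ = 1 ∧
        ∀ x, x ∉ Set.range e → σ x = ρ x),
      ∏ i ∈ Finset.univ.filter (fun i => i ≤ σ i), B i (σ i)
    = (∏ x ∈ (Finset.univ.map e.toEmbedding)ᶜ, if x ≤ ρ x then B x (ρ x) else 1)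
      * lhaf (B.submatrix e e) := by
  have hnr : ∀ x, x ∉ Set.range e → ρ x ∉ Set.range e := by
    rintro x hx ⟨i, hi⟩
    apply hx
    refine ⟨i, ?_⟩
    rw [← hρ x, ← hi, hρe]
  have h1 : ∀ (τ : Equiv.Perm (Fin m)) (i : Fin m),
      (ρ * τ.viaFintypeEmbedding e.toEmbedding) (e i) = e (τ i) := by
    intro τ i
    have := Equiv.Perm.viaFintypeEmbedding_apply_image τ e.toEmbedding i
    simp only [RelEmbedding.coe_toEmbedding] at this
    rw [Equiv.Perm.mul_apply, this, hρe]
  have h2 : ∀ (τ : Equiv.Perm (Fin m)) (x : Fin n), x ∉ Set.range e →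
      (ρ * τ.viaFintypeEmbedding e.toEmbedding) x = ρ x := by
    intro τ x hx
    rw [Equiv.Perm.mul_apply, Equiv.Perm.viaFintypeEmbedding_apply_notMem_range]
    simpa using hx
  rw [lhaf, Finset.mul_sum]
  symm
  refine Finset.sum_nbij (fun τ => ρ * τ.viaFintypeEmbedding e.toEmbedding) ?_ ?_ ?_ ?_
  · intro τ hτ
    simp only [Finset.mem_filter, Finset.mem_univ, true_and] at hτ ⊢
    refine ⟨?_, h2 τ⟩
    ext1 x
    by_cases hx : x ∈ Set.range e
    · obtain ⟨i, rfl⟩ := hx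
      rw [Equiv.Perm.mul_apply, h1, h1, ← Equiv.Perm.mul_apply, hτ]; rfl
    · rw [Equiv.Perm.mul_apply, h2 τ x hx, h2 τ _ (hnr x hx), hρ]; rfl
  · intro τ _ τ' _ h
    ext1 i
    apply e.injective
    rw [← h1, ← h1]
    exact congrArg (fun f : Equiv.Perm (Fin n) => f (e i)) h
  · intro σ hσ
    simp only [Finset.coe_filter, Finset.mem_univ, true_and, Set.mem_ofPred_eq] at hσ
    obtain ⟨hσ, hσ2⟩ := hσ
    have hσ' : ∀ x, σ (σ x) = x := fun x => by rw [← Equiv.Perm.mul_apply, hσ]; rfl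
    have hr : ∀ i, ∃ k, e k = σ (e i) := by
      intro i
      by_contra hc
      have hc' : σ (e i) ∉ Set.range e := hc
      have h3 := hσ2 _ hc'
      rw [hσ'] at h3
      exact hnr _ hc' ⟨i, h3⟩
    choose t ht using hr
    have hinv : Function.Involutive t := by
      intro i
      apply e.injective
      rw [ht, ht, hσ']
    refine ⟨hinv.toPerm t, ?_, ?_⟩
    · simp only [Finset.coe_filter, Finset.mem_univ, true_and, Set.mem_ofPred_eq]
      ext1 i
      exact hinv i
    · ext1 x
      by_cases hx : x ∈ Set.range e
      · obtain ⟨i, rfl⟩ := hx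
        simp only [h1]
        exact ht i
      · simp only [h2 _ x hx, hσ2 x hx]
  · intro τ _
    rw [Finset.prod_filter, Finset.prod_filter,
      ← Finset.prod_mul_prod_compl (Finset.univ.map e.toEmbedding) (fun x => 
        if x ≤ (ρ * τ.viaFintypeEmbedding e.toEmbedding) x then _ else _), mul_comm]
    congr 1
    · rw [Finset.prod_map]
      refine Finset.prod_congr rfl fun i _ => ?_
      simp only [RelEmbedding.coe_toEmbedding, h1, Matrix.submatrix_apply, e.le_iff_le]
    · refine Finset.prod_congr rfl fun x hx => ?_
      have hx' : x ∉ Set.range e := by simpa using hx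
      simp only [h2 _ x hx']

/-- the order embedding skipping `0` and `j.succ` -/
def skipTwo {d : ℕ} (j : Fin (d + 1)) : Fin d ↪o Fin (d + 2) :=
  (Fin.succAboveOrderEmb j).trans (Fin.succOrderEmb (d + 1))

lemma skipTwo_range {d : ℕ} (j : Fin (d + 1)) (x : Fin (d+2)) :
    x ∉ Set.range (skipTwo j) ↔ x = 0 ∨ x = j.succ := by
  constructor
  · intro h
    induction x using Fin.cases with
    | zero => simp
    | succ x =>
      right
      by_contra hne
      have hne' : x ≠ j := fun h => hne (by rw [h])
      obtain ⟨y, hy⟩ := Fin.exists_succAbove_eq hne'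
      exact h ⟨y, by simp [skipTwo, hy]⟩
  · rintro (rfl | rfl) ⟨y, hy⟩
    · simp [skipTwo] at hy
    · simp [skipTwo, Fin.succAbove_ne] at hy

lemma lhaf_zero (B : Matrix (Fin 0) (Fin 0) ℂ) : lhaf B = 1 := by
  have : (Finset.univ.filter fun σ : Equiv.Perm (Fin 0) => σ * σ = 1) = {1} := by
    ext σ; simp [Subsingleton.elim σ 1]
  rw [lhaf, this]; simp

lemma lhaf_fiber_zero {d : ℕ} (B : Matrix (Fin (d+1)) (Fin (d+1)) ℂ) :
    ∑ σ ∈ Finset.univ.filter (fun σ : Equiv.Perm (Fin (d+1)) => σ * σ = 1) with σ 0 = 0,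
      ∏ i ∈ Finset.univ.filter (fun i => i ≤ σ i), B i (σ i)
    = B 0 0 * lhaf (B.submatrix Fin.succ Fin.succ) := by
  have hr : ∀ x, x ∉ Set.range (Fin.succOrderEmb d) ↔ x = 0 := by
    intro x
    induction x using Fin.cases with
    | zero => simp
    | succ x => simp
  have h := lhaf_fiber B (Fin.succOrderEmb d) 1 (fun x => rfl) (fun i => rfl)
  have hs : (Finset.univ.map (Fin.succOrderEmb d).toEmbedding)ᶜ = {0} := by
    ext x
    simp
  rw [hs, Finset.prod_singleton] at h
  simp only [Equiv.Perm.one_apply, le_refl, if_true] at h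
  rw [Finset.filter_filter]
  refine Eq.trans (Finset.sum_congr ?_ fun _ _ => rfl) h
  ext σ
  simp only [Finset.mem_filter, hr, forall_eq]

lemma lhaf_fiber_succ {d : ℕ} (B : Matrix (Fin (d+2)) (Fin (d+2)) ℂ) (j : Fin (d+1)) :
    ∑ σ ∈ Finset.univ.filter (fun σ : Equiv.Perm (Fin (d+2)) => σ * σ = 1) with σ 0 = j.succ,
      ∏ i ∈ Finset.univ.filter (fun i => i ≤ σ i), B i (σ i)
    = B 0 j.succ * lhaf (B.submatrix (skipTwo j) (skipTwo j)) := by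
  have h := lhaf_fiber B (skipTwo j) (Equiv.swap 0 j.succ) (fun x => by simp) (fun i => by
    have : skipTwo j i ∈ Set.range (skipTwo j) := ⟨i, rfl⟩
    have h2 := (skipTwo_range j (skipTwo j i)).not.1 (not_not.2 this)
    push Not at h2
    exact Equiv.swap_apply_of_ne_of_ne h2.1 h2.2)
  have hs : (Finset.univ.map (skipTwo j).toEmbedding)ᶜ = {0, j.succ} := by
    ext x
    have := skipTwo_range j x
    simp only [Set.mem_range] at this
    simpa using this
  rw [hs, Finset.prod_pair (Fin.succ_ne_zero j).symm] at h
  simp only [Equiv.swap_apply_left, Equiv.swap_apply_right, Fin.zero_le, if_true] at h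
  rw [if_neg (not_le.2 (Fin.succ_pos j)), mul_one] at h
  rw [Finset.filter_filter]
  refine Eq.trans (Finset.sum_congr ?_ fun _ _ => rfl) h
  ext σ
  simp only [Finset.mem_filter, skipTwo_range, forall_eq_or_imp, forall_eq, Finset.mem_univ,
    true_and, Equiv.swap_apply_left, Equiv.swap_apply_right]
  constructor
  · rintro ⟨h1, h2⟩
    refine ⟨h1, h2, ?_⟩
    rw [← h2, ← Equiv.Perm.mul_apply, h1]; rfl
  · rintro ⟨h1, h2, h3⟩
    exact ⟨h1, h2⟩

lemma lhaf_one (B : Matrix (Fin 1) (Fin 1) ℂ) : lhaf B = B 0 0 := by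
  have : (Finset.univ.filter fun σ : Equiv.Perm (Fin 1) => σ * σ = 1) = {1} := by
    ext σ; simp [Subsingleton.elim σ 1]
  rw [lhaf, this]; simp

lemma lhaf_succ_succ {d : ℕ} (B : Matrix (Fin (d+2)) (Fin (d+2)) ℂ) :
    lhaf B = B 0 0 * lhaf (B.submatrix Fin.succ Fin.succ)
      + ∑ j : Fin (d+1), B 0 j.succ * lhaf (B.submatrix (skipTwo j) (skipTwo j)) := by
  rw [lhaf, ← Finset.sum_fiberwise _ (fun σ : Equiv.Perm (Fin (d+2)) => σ 0), Fin.sum_univ_succ,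
    lhaf_fiber_zero]
  congr 1
  exact Finset.sum_congr rfl fun j _ => lhaf_fiber_succ B j

lemma filldiag_submatrix {d d' : ℕ} (A : Matrix (Fin d) (Fin d) ℂ) (γ : Fin d → ℂ)
    (f : Fin d' → Fin d) (hf : Function.Injective f) :
    (filldiag A γ).submatrix f f = filldiag (A.submatrix f f) (γ ∘ f) := by
  ext i j
  simp [filldiag, hf.eq_iff]

lemma eraseIdx_ofFn_aux {α : Type*} {d : ℕ} (w : Fin (d+1) → α) (j : Fin (d+1)) :
    (List.ofFn w).eraseIdx j = List.ofFn (w ∘ j.succAbove) := by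
  apply List.ext_getElem
  · rw [List.length_eraseIdx_of_lt (by rw [List.length_ofFn]; exact j.2)]; simp
  · intro i h1 h2
    simp only [List.length_ofFn] at h2
    rw [List.getElem_eraseIdx]
    simp only [List.getElem_ofFn, Function.comp, Fin.succAbove, Fin.lt_def, Fin.val_castSucc]
    split_ifs <;> rfl

lemma lhafv_eq_LL {ι : Type*} (A : Matrix ι ι ℂ) (γ : ι → ℂ) (d : ℕ) (w : Fin d → ι) :
    lhafv (A.submatrix w w) (γ ∘ w) = LL (fun a b => A a b) γ (List.ofFn w) := by
  induction d using Nat.strong_induction_on with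
  | _ d ih =>
  match d with
  | 0 => simp [lhafv, lhaf_zero, LL_nil]
  | 1 => simp [lhafv, lhaf_one, LL_nil, LL_cons, filldiag, rmv_nil]
  | d + 2 =>
    rw [lhafv, lhaf_succ_succ, List.ofFn_succ, LL_cons, rmv_eq_sum,
      filldiag_submatrix _ _ _ (Fin.succ_injective _)]
    have h1 := ih (d+1) (by omega) (w ∘ Fin.succ)
    congr 1
    · have h2 : filldiag (A.submatrix w w) (γ ∘ w) 0 0 = γ (w 0) := by simp [filldiag]
      rw [h2]
      congr 1
    · refine Fintype.sum_equiv (finCongr (by simp)) _ _ fun j => ?_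
      rw [filldiag_submatrix _ _ _ (skipTwo j).injective]
      have h2 := ih d (by omega) (w ∘ skipTwo j)
      have h3 : filldiag (A.submatrix w w) (γ ∘ w) 0 j.succ = A (w 0) (w j.succ) := by
        simp [filldiag, (Fin.succ_ne_zero j).symm]
      have h4 := eraseIdx_ofFn_aux (fun i : Fin (d+1) => w i.succ) j
      rw [h3]
      congr 1
      · simp [-List.ofFn_succ]
      · simp only [finCongr_apply, Fin.val_cast]
        rw [h4]
        exact h2

end LhafPart
section PSPart
open PowerSeries

/-- truncated exponential -/
def expTrunc (c : PowerSeries ℂ) (n : ℕ) : PowerSeries ℂ :=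
  ∑ j ∈ Finset.range (n + 1), C ((j.factorial : ℂ)⁻¹) * c ^ j

/-- exponential of a power series without constant term -/
def expS (c : PowerSeries ℂ) : PowerSeries ℂ := mk fun n => coeff n (expTrunc c n)

lemma coeff_pow_zero_of_lt (c : PowerSeries ℂ) (hc : X ∣ c) (n j : ℕ) (h : n < j) :
    coeff n (c ^ j) = 0 :=
  (X_pow_dvd_iff.1 (pow_dvd_pow_of_dvd hc j)) n h

lemma coeff_expTrunc (c : PowerSeries ℂ) (hc : X ∣ c) (n m : ℕ) (h : n ≤ m) :
    coeff n (expTrunc c m) = coeff n (expS c) := by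
  rw [expS, coeff_mk]
  induction m, h using Nat.le_induction with
  | base => rfl
  | succ m hm ih =>
    rw [← ih]
    unfold expTrunc
    rw [Finset.sum_range_succ _ (m + 1), map_add, coeff_C_mul,
      coeff_pow_zero_of_lt c hc n (m + 1) (by omega)]
    simp

lemma derivative_expTrunc (c : PowerSeries ℂ) (n : ℕ) :
    derivative ℂ (expTrunc c (n + 1)) = expTrunc c n * derivative ℂ c := by
  unfold expTrunc
  rw [map_sum, Finset.sum_range_succ', Finset.sum_mul]
  have h0 : derivative ℂ (C (((Nat.factorial 0 : ℕ) : ℂ)⁻¹) * c ^ 0) = 0 := by simp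
  rw [h0, add_zero]
  refine Finset.sum_congr rfl fun j _ => ?_
  rw [Derivation.leibniz, derivative_pow, derivative_C, smul_zero, add_zero, smul_eq_mul]
  have h1 : ((j.factorial : ℂ)⁻¹) = (((j+1).factorial : ℕ) : ℂ)⁻¹ * ((j + 1 : ℕ) : ℂ) := by
    rw [Nat.factorial_succ]
    push_cast
    have := Nat.cast_add_one_ne_zero (R := ℂ) j
    field_simp
  rw [h1, map_mul, map_natCast]
  simp only [Nat.add_sub_cancel]
  ring

lemma derivative_expS (c : PowerSeries ℂ) (hc : X ∣ c) :
    derivative ℂ (expS c) = expS c * derivative ℂ c := by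
  ext n
  rw [coeff_derivative, ← coeff_expTrunc c hc (n+1) (n+1) le_rfl, ← coeff_derivative,
    derivative_expTrunc, coeff_mul, coeff_mul]
  refine Finset.sum_congr rfl fun p hp => ?_
  rw [coeff_expTrunc c hc _ _ (by have := Finset.HasAntidiagonal.mem_antidiagonal.1 hp; omega)]

lemma constantCoeff_expS (c : PowerSeries ℂ) : coeff 0 (expS c) = 1 := by
  simp [expS, expTrunc]

variable {ι : Type*} [Fintype ι] [DecidableEq ι]

/-- `A(η)` -/
def As (S A : Matrix ι ι ℂ) (a b : ι) : PowerSeries ℂ := mk fun k => (A * (S * A) ^ k) a b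
/-- `γ(η)` -/
def gs (S A : Matrix ι ι ℂ) (γ : ι → ℂ) (a : ι) : PowerSeries ℂ :=
  mk fun k => ((A * S) ^ k *ᵥ γ) a
/-- constant series `S` -/
def Ss (S : Matrix ι ι ℂ) (a b : ι) : PowerSeries ℂ := C (S a b)

lemma coeff_bilin (S : Matrix ι ι ℂ) (f g : ι → PowerSeries ℂ) (n : ℕ) :
    coeff n (∑ a, ∑ b, Ss S a b * (f a * g b)) =
      ∑ p ∈ Finset.HasAntidiagonal.antidiagonal n,
        (fun a => coeff p.1 (f a)) ⬝ᵥ (S *ᵥ (fun b => coeff p.2 (g b))) := by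
  simp only [map_sum, Ss, coeff_C_mul]
  simp only [coeff_mul, dotProduct, mulVec, Finset.mul_sum]
  rw [Finset.sum_comm' (t' := Finset.univ) (s' := fun _ => Finset.HasAntidiagonal.antidiagonal n) (by simp)]
  refine Finset.sum_congr rfl fun a _ => ?_
  rw [Finset.sum_comm]
  refine Finset.sum_congr rfl fun b _ => Finset.sum_congr rfl fun p _ => ?_
  ring

lemma pow_shift (S A : Matrix ι ι ℂ) (k : ℕ) : (A * S) ^ k * A = A * (S * A) ^ k := by
  induction k with
  | zero => simp
  | succ k ih => rw [pow_succ', pow_succ, mul_assoc, ih]; 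
                 simp only [mul_assoc]
                 rw [← mul_assoc S A, ← pow_succ', ← pow_succ]

lemma As_symm (S A : Matrix ι ι ℂ) (hS : S.IsSymm) (hA : A.IsSymm) (a b : ι) :
    As S A a b = As S A b a := by
  ext k
  have : (A * (S * A) ^ k)ᵀ = A * (S * A) ^ k := by
    rw [transpose_mul, transpose_pow, transpose_mul, hS.eq, hA.eq, pow_shift]
  simp only [As, coeff_mk]
  conv_rhs => rw [← this]
  rfl

lemma D_As (S A : Matrix ι ι ℂ) (c d : ι) :
    derivative ℂ (As S A c d) = ∑ a, ∑ b, Ss S a b * (As S A c a * As S A b d) := by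
  ext n
  rw [coeff_derivative, coeff_bilin]
  simp only [As, coeff_mk]
  have h : ∀ p ∈ Finset.HasAntidiagonal.antidiagonal n, (fun a => (A * (S * A) ^ p.1) c a) ⬝ᵥ
      (S *ᵥ (fun b => (A * (S * A) ^ p.2) b d)) = (A * (S * A) ^ (n + 1)) c d := by
    intro p hp
    rw [Finset.HasAntidiagonal.mem_antidiagonal] at hp
    have : A * (S * A) ^ (n + 1) = (A * (S * A) ^ p.1) * (S * (A * (S * A) ^ p.2)) := by
      rw [← hp, add_assoc, pow_add, pow_succ']; simp only [mul_assoc]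
    rw [this]
    rfl
  rw [Finset.sum_congr rfl h]
  simp [mul_comm]

lemma D_gs (S A : Matrix ι ι ℂ) (γ : ι → ℂ) (c : ι) :
    derivative ℂ (gs S A γ c) = ∑ a, ∑ b, Ss S a b * (As S A c a * gs S A γ b) := by
  ext n
  rw [coeff_derivative, coeff_bilin]
  simp only [As, gs, coeff_mk]
  have h : ∀ p ∈ Finset.HasAntidiagonal.antidiagonal n, (fun a => (A * (S * A) ^ p.1) c a) ⬝ᵥ
      (S *ᵥ (fun b => ((A * S) ^ p.2 *ᵥ γ) b)) = ((A * S) ^ (n + 1) *ᵥ γ) c := by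
    intro p hp
    rw [Finset.HasAntidiagonal.mem_antidiagonal] at hp
    have : (A * S) ^ (n + 1) = (A * (S * A) ^ p.1) * (S * (A * S) ^ p.2) := by
      rw [← pow_shift, ← hp, add_assoc, pow_add, add_comm p.2, pow_add, pow_one]
      simp only [mul_assoc]
    rw [this, ← mulVec_mulVec _ (A * (S * A) ^ p.1), ← mulVec_mulVec _ S]
    rfl
  rw [Finset.sum_congr rfl h]
  simp [mul_comm]

lemma c_deriv (S A : Matrix ι ι ℂ) (hS : S.IsSymm) (hA : A.IsSymm) (γ : ι → ℂ)
    (g : ℕ → ℂ) (hg : ∀ k, 1 ≤ k → g k = (2 * k : ℂ)⁻¹ * ((S * A) ^ k).trace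
      + 2⁻¹ * (γ ⬝ᵥ (((S * A) ^ (k - 1) * S) *ᵥ γ))) :
    2 * derivative ℂ (mk g) =
      ∑ a, ∑ b, Ss S a b * (As S A a b + gs S A γ a * gs S A γ b) := by
  ext n
  simp only [mul_add, Finset.sum_add_distrib]
  rw [map_add, coeff_bilin, show (2 : PowerSeries ℂ) = C 2 from (map_ofNat C 2).symm,
    coeff_C_mul, coeff_derivative, coeff_mk, hg _ (by omega)]
  have h1 : coeff n (∑ a, ∑ b, Ss S a b * As S A a b) = ((S * A) ^ (n + 1)).trace := by
    simp only [map_sum, Ss, As, coeff_C_mul, coeff_mk]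
    rw [pow_succ', mul_assoc, Matrix.trace]
    simp only [Matrix.diag]
    rw [Finset.sum_comm]
    refine Finset.sum_congr rfl fun a _ => ?_
    rw [Matrix.mul_apply]
    refine Finset.sum_congr rfl fun b _ => ?_
    rw [hS.apply]
  have h2 : ∀ p ∈ Finset.HasAntidiagonal.antidiagonal n, (fun a => coeff p.1 (gs S A γ a)) ⬝ᵥ
      (S *ᵥ (fun b => coeff p.2 (gs S A γ b))) = γ ⬝ᵥ (((S * A) ^ n * S) *ᵥ γ) := by
    intro p hp
    rw [Finset.HasAntidiagonal.mem_antidiagonal] at hp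
    simp only [gs, coeff_mk]
    have e : (S * A) ^ n * S = (S * A) ^ p.1 * (S * (A * S) ^ p.2) := by
      rw [← pow_shift A S, ← hp, pow_add, mul_assoc]
    have e2 : ((A * S) ^ p.1)ᵀ = (S * A) ^ p.1 := by
      rw [transpose_pow, transpose_mul, hS.eq, hA.eq]
    rw [e, ← mulVec_mulVec, ← mulVec_mulVec, dotProduct_mulVec γ, ← e2, vecMul_transpose]
  rw [h1, Finset.sum_congr rfl h2]
  have := Nat.cast_add_one_ne_zero (R := ℂ) n
  simp only [Finset.sum_const, Finset.Nat.card_antidiagonal, nsmul_eq_mul, Nat.add_sub_cancel]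
  push_cast
  field_simp

lemma D_main (S A : Matrix ι ι ℂ) (hS : S.IsSymm) (hA : A.IsSymm) (γ : ι → ℂ)
    (g : ℕ → ℂ) (hg0 : g 0 = 0) (hg : ∀ k, 1 ≤ k → g k = (2 * k : ℂ)⁻¹ * ((S * A) ^ k).trace
      + 2⁻¹ * (γ ⬝ᵥ (((S * A) ^ (k - 1) * S) *ᵥ γ))) (w : List ι) :
    2 * derivative ℂ (expS (mk g) * LL (As S A) (gs S A γ) w) =
      ∑ a, ∑ b, Ss S a b * (expS (mk g) * LL (As S A) (gs S A γ) (a :: b :: w)) := by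
  have hX : X ∣ mk g := by
    rw [X_dvd_iff]; simpa using hg0
  have h1 := D_LL (derivative ℂ) (Ss S) (As S A) (gs S A γ) (As_symm S A hS hA)
    (fun a b => by simp only [Ss]; rw [hS.apply]) (D_gs S A γ) (D_As S A) w
  have h2 := TT_LL (Ss S) (As S A) (gs S A γ) w
  rw [← h1, ← c_deriv S A hS hA γ g hg] at h2
  have h3 : ∑ a, ∑ b, Ss S a b * (expS (mk g) * LL (As S A) (gs S A γ) (a :: b :: w)) =
      expS (mk g) * ∑ a, ∑ b, Ss S a b * LL (As S A) (gs S A γ) (a :: b :: w) := by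
    simp only [Finset.mul_sum]
    refine Finset.sum_congr rfl fun a _ => Finset.sum_congr rfl fun b _ => ?_
    ring
  rw [h3, ← h2, Derivation.leibniz, derivative_expS _ hX]
  simp only [smul_eq_mul]
  ring

lemma coeff_zero_LL (S A : Matrix ι ι ℂ) (γ : ι → ℂ) (w : List ι) :
    coeff 0 (LL (As S A) (gs S A γ) w) = LL (fun a b => A a b) γ w := by
  rw [coeff_zero_eq_constantCoeff_apply, map_LL]
  congr 1
  · funext a b
    rw [← coeff_zero_eq_constantCoeff_apply]; simp [As]
  · funext a
    rw [← coeff_zero_eq_constantCoeff_apply]; simp [gs]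

lemma fN_eq (N : ℕ) {κ : Type*} [Fintype κ] [DecidableEq κ] (A : Matrix (κ ⊕ κ) (κ ⊕ κ) ℂ)
    (γ : κ ⊕ κ → ℂ) (z : κ → ℂ) :
    fN N A γ z = coeff N (expS (mk fun k => if k = 0 then 0 else gfun A γ z k)) := by
  set c : PowerSeries ℂ := mk fun k => if k = 0 then 0 else gfun A γ z k with hc
  have hX : X ∣ c := by
    rw [X_dvd_iff]; simp [hc]
  rw [← coeff_expTrunc c hX N N le_rfl, fN, expTrunc, Polynomial.finsetSum_coeff, map_sum]
  refine Finset.sum_congr rfl fun j _ => ?_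
  rw [Polynomial.coeff_C_mul, coeff_C_mul, Ring.inverse_eq_inv]
  congr 1
  rw [← Polynomial.coeff_coe, Polynomial.coe_pow]
  set P : Polynomial ℂ := ∑ k ∈ Finset.Icc 1 N, Polynomial.C (gfun A γ z k) * Polynomial.X ^ k
    with hP
  have h1 : (X : PowerSeries ℂ) ^ (N + 1) ∣ (P : PowerSeries ℂ) - c := by
    rw [X_pow_dvd_iff]
    intro m hm
    rw [map_sub, Polynomial.coeff_coe, hP, Polynomial.finsetSum_coeff]
    simp only [Polynomial.coeff_C_mul_X_pow, hc, coeff_mk]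
    rw [Finset.sum_ite_eq]
    by_cases h0 : m = 0
    · simp [h0]
    · rw [if_pos (by simp; omega), if_neg h0, sub_self]
  have h2 := (X_pow_dvd_iff.1 (h1.trans (sub_dvd_pow_sub_pow _ _ j))) N (by omega)
  rw [map_sub] at h2
  exact sub_eq_zero.1 h2

end PSPart
section Final
open PowerSeries

lemma count_repList {M : ℕ} (n : Fin M → ℕ) (k : Fin M) : (repList n).count k = n k := by
  unfold repList
  rw [List.count_flatMap]
  have : (List.count k ∘ fun j => List.replicate (n j) j) = fun j => if j = k then n j else 0 := by
    funext j
    simp [List.count_replicate]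
  rw [this, ← Fin.sum_univ_def]
  simp

lemma repList_add_single {M : ℕ} (n : Fin M → ℕ) (i : Fin M) :
    (repList (n + Pi.single i 1)).Perm (i :: repList n) := by
  rw [List.perm_iff_count]
  intro k
  rw [count_repList, List.count_cons, count_repList]
  by_cases h : k = i
  · subst h; simp
  · simp [h, Ne.symm h]

/-- the word of `n ⊕ n` -/
def wd {M : ℕ} (n : Fin M → ℕ) : List (Fin M ⊕ Fin M) :=
  (repList n).map Sum.inl ++ (repList n).map Sum.inr

lemma wd_add_single {M : ℕ} (n : Fin M → ℕ) (i : Fin M) (w : List (Fin M ⊕ Fin M)) :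
    (wd (n + Pi.single i 1) ++ w).Perm (wd n ++ (Sum.inl i :: Sum.inr i :: w)) := by
  have h := repList_add_single n i
  have h1 := ((h.map (Sum.inl : Fin M → Fin M ⊕ Fin M)).append
    (h.map (Sum.inr : Fin M → Fin M ⊕ Fin M))).append_right w
  refine h1.trans ?_
  have h2 := (List.perm_middle (a := (Sum.inl i : Fin M ⊕ Fin M)) (l₁ := wd n)
    (l₂ := Sum.inr i :: w)).trans ((List.perm_middle (a := (Sum.inr i : Fin M ⊕ Fin M))
    (l₁ := wd n) (l₂ := w)).cons _)
  refine List.Perm.trans ?_ h2.symm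
  have h3 := (List.perm_middle (a := (Sum.inr i : Fin M ⊕ Fin M))
    (l₁ := (repList n).map Sum.inl) (l₂ := (repList n).map Sum.inr ++ w)).cons (Sum.inl i)
  simpa [wd] using h3

lemma ofFn_rep {M : ℕ} (n : Fin M → ℕ) : List.ofFn (rep n) = repList n := by
  apply List.ext_getElem
  · simp [repList_length]
  · intro i h1 h2
    simp [rep]

lemma ofFn_dbl {M : ℕ} (n : Fin M → ℕ) : List.ofFn (dbl n n) = wd n := by
  have h : dbl n n = Fin.append (Sum.inl ∘ rep n) (Sum.inr ∘ rep n) := by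
    funext x
    induction x using Fin.addCases with
    | left x => simp [dbl]
    | right x =>
      rw [Fin.append_right, dbl, Function.comp_apply, finSumFinEquiv_symm_apply_natAdd]
      rfl
  rw [h, List.ofFn_fin_append, wd, ← ofFn_rep, List.map_ofFn, List.map_ofFn]

/-- index set -/
def PP (M N : ℕ) : Finset (Fin M → ℕ) :=
  (Fintype.piFinset fun _ : Fin M => Finset.range (N + 1)).filter (fun n => ∑ i, n i = N)

lemma mem_PP {M N : ℕ} (n : Fin M → ℕ) : n ∈ PP M N ↔ ∑ i, n i = N := by
  simp only [PP, Finset.mem_filter, Fintype.mem_piFinset, Finset.mem_range, and_iff_right_iff_imp]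
  intro h i
  have := Finset.single_le_sum (f := n) (fun j _ => Nat.zero_le _) (Finset.mem_univ i)
  omega

/-- weight -/
def wt {M : ℕ} (z : Fin M → ℂ) (n : Fin M → ℕ) : ℂ := ∏ i, z i ^ n i / (n i).factorial

lemma wt_add_single {M : ℕ} (z : Fin M → ℂ) (n : Fin M → ℕ) (i : Fin M) :
    ((n i : ℂ) + 1) * wt z (n + Pi.single i 1) = z i * wt z n := by
  unfold wt
  rw [← Finset.mul_prod_erase Finset.univ _ (Finset.mem_univ i),
    ← Finset.mul_prod_erase Finset.univ (fun i => z i ^ n i / ((n i).factorial : ℂ))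
      (Finset.mem_univ i)]
  have h : ∀ k ∈ Finset.univ.erase i, z k ^ (n + Pi.single i 1 : Fin M → ℕ) k /
      (((n + Pi.single i 1 : Fin M → ℕ) k).factorial : ℂ) = z k ^ n k / ((n k).factorial : ℂ) := by
    intro k hk
    have : k ≠ i := Finset.ne_of_mem_erase hk
    simp [this]
  rw [Finset.prod_congr rfl h, ← mul_assoc, ← mul_assoc]
  congr 1
  simp only [Pi.add_apply, Pi.single_eq_same, Nat.factorial_succ]
  have := Nat.cast_add_one_ne_zero (R := ℂ) (n i)
  have h2 : ((n i).factorial : ℂ) ≠ 0 := Nat.cast_ne_zero.2 (Nat.factorial_ne_zero _)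
  push_cast
  field_simp
  ring

/-- left-hand side with a spectator word -/
def KK {M : ℕ} (L : List (Fin M ⊕ Fin M) → ℂ) (z : Fin M → ℂ) (N : ℕ)
    (w : List (Fin M ⊕ Fin M)) : ℂ :=
  ∑ n ∈ PP M N, L (wd n ++ w) * wt z n

lemma KK_succ {M : ℕ} (L : List (Fin M ⊕ Fin M) → ℂ) (hL : ∀ u u', u.Perm u' → L u = L u')
    (z : Fin M → ℂ) (N : ℕ) (w : List (Fin M ⊕ Fin M)) :
    ((N : ℂ) + 1) * KK L z (N + 1) w =
      ∑ i, z i * KK L z N (Sum.inl i :: Sum.inr i :: w) := by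
  have h1 : ((N : ℂ) + 1) * KK L z (N + 1) w =
      ∑ n ∈ PP M (N + 1), ∑ i, (n i : ℂ) * (L (wd n ++ w) * wt z n) := by
    unfold KK
    rw [Finset.mul_sum]
    refine Finset.sum_congr rfl fun n hn => ?_
    rw [← Finset.sum_mul]
    congr 1
    rw [mem_PP] at hn
    exact_mod_cast hn.symm
  rw [h1, Finset.sum_comm]
  refine Finset.sum_congr rfl fun i _ => ?_
  unfold KK
  rw [Finset.mul_sum]
  symm
  refine Finset.sum_of_injOn (fun n => n + Pi.single i 1) ?_ ?_ ?_ ?_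
  · intro n _ n' _ h
    exact add_right_cancel h
  · intro n hn
    simp only [Finset.mem_coe, mem_PP] at hn ⊢
    simp [Finset.sum_add_distrib, hn]
  · intro n hn hn'
    by_cases h0 : n i = 0
    · simp [h0]
    · exfalso
      apply hn'
      have he : (n - Pi.single i 1) + Pi.single i 1 = n := by
        funext k
        by_cases hk : k = i
        · subst hk; simp; omega
        · simp [hk]
      refine ⟨n - Pi.single i 1, ?_, he⟩
      simp only [Finset.mem_coe, mem_PP] at hn ⊢
      rw [← he] at hn
      simp only [Pi.add_apply, Finset.sum_add_distrib, Finset.sum_pi_single', Finset.mem_univ,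
        if_true] at hn
      simpa using hn
  · intro n _
    rw [hL _ _ (wd_add_single n i w)]
    have := wt_add_single z n i
    simp only [Pi.add_apply, Pi.single_eq_same]
    push_cast
    linear_combination (-L (wd n ++ Sum.inl i :: Sum.inr i :: w)) * this

lemma KK_zero {M : ℕ} (L : List (Fin M ⊕ Fin M) → ℂ) (z : Fin M → ℂ) 
    (w : List (Fin M ⊕ Fin M)) : KK L z 0 w = L w := by
  have : PP M 0 = {0} := by
    ext n; rw [mem_PP]; simp [funext_iff]
  have h2 : wd (0 : Fin M → ℕ) = [] := by simp [wd, repList]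
  simp [KK, this, h2, wt]

lemma DX_eq {M : ℕ} (z : Fin M → ℂ) : Dmat z * Xmat (Fin M) ℂ =
    Matrix.fromBlocks 0 (Matrix.diagonal z) (Matrix.diagonal z) 0 := by
  have : Dmat z = Matrix.fromBlocks (Matrix.diagonal z) 0 0 (Matrix.diagonal z) := by
    rw [Dmat, Matrix.fromBlocks_diagonal]
  rw [this, Xmat, Matrix.fromBlocks_multiply]
  simp

lemma DX_symm {M : ℕ} (z : Fin M → ℂ) : (Dmat z * Xmat (Fin M) ℂ).IsSymm := by
  rw [DX_eq, Matrix.IsSymm, Matrix.fromBlocks_transpose]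
  simp

lemma DX_sum {M : ℕ} (z : Fin M → ℂ) (F : Fin M ⊕ Fin M → Fin M ⊕ Fin M → ℂ) :
    ∑ a, ∑ b, (Dmat z * Xmat (Fin M) ℂ) a b * F a b =
      ∑ i, z i * (F (Sum.inl i) (Sum.inr i) + F (Sum.inr i) (Sum.inl i)) := by
  rw [DX_eq]
  simp [Fintype.sum_sum_type, Matrix.diagonal_apply, mul_add, Finset.sum_add_distrib, add_comm]

lemma coeff_eq_KK {M : ℕ} (A : Matrix (Fin M ⊕ Fin M) (Fin M ⊕ Fin M) ℂ) (hA : A.IsSymm)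
    (γ : Fin M ⊕ Fin M → ℂ) (z : Fin M → ℂ) (N : ℕ) (w : List (Fin M ⊕ Fin M)) :
    coeff N (expS (mk fun k => if k = 0 then 0 else gfun A γ z k) *
        LL (As (Dmat z * Xmat (Fin M) ℂ) A) (gs (Dmat z * Xmat (Fin M) ℂ) A γ) w)
      = KK (LL (fun a b => A a b) γ) z N w := by
  set S := Dmat z * Xmat (Fin M) ℂ with hSdef
  have hS : S.IsSymm := DX_symm z
  have hAf : ∀ a b, (fun a b => A a b) a b = (fun a b => A a b) b a := fun a b => (hA.apply a b).symm
  induction N generalizing w with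
  | zero =>
    rw [KK_zero, coeff_zero_eq_constantCoeff_apply, map_mul, ← coeff_zero_eq_constantCoeff_apply,
      ← coeff_zero_eq_constantCoeff_apply, constantCoeff_expS, coeff_zero_LL, one_mul]
  | succ N ih =>
    have hD := D_main S A hS hA γ (fun k => if k = 0 then 0 else gfun A γ z k) (by simp) (by
      intro k hk
      rw [if_neg (by omega)]
      simp only [gfun, Ring.inverse_eq_inv, ← hSdef]
      push_cast
      rfl) w
    have hD2 := congrArg (coeff N) hD
    rw [show (2 : PowerSeries ℂ) = C 2 from (map_ofNat C 2).symm, coeff_C_mul,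
      coeff_derivative] at hD2
    simp only [map_sum, Ss, coeff_C_mul, ih] at hD2
    rw [hSdef, DX_sum] at hD2
    have hsw : ∀ i, KK (LL (fun a b => A a b) γ) z N (Sum.inr i :: Sum.inl i :: w) =
        KK (LL (fun a b => A a b) γ) z N (Sum.inl i :: Sum.inr i :: w) := by
      intro i
      unfold KK
      refine Finset.sum_congr rfl fun n _ => ?_
      rw [LL_perm _ hAf γ ((List.Perm.swap _ _ w).append_left (wd n))]
    simp only [hsw, ← two_mul, mul_left_comm _ (2:ℂ)] at hD2
    rw [← Finset.mul_sum, ← KK_succ _ (fun u u' h => LL_perm _ hAf γ h)] at hD2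
    have h0 := Nat.cast_add_one_ne_zero (R := ℂ) N
    have h3 := mul_left_cancel₀ (two_ne_zero' ℂ) hD2
    rw [mul_comm] at h3
    exact mul_left_cancel₀ h0 h3

end Final

/-- Loop Hafnian master theorem (fixed total photon number form):
`Σ_{n ∈ ℕ^M, Σ n = N} lhaf(A_{n⊕n}, γ_{n⊕n}) · Π_i z_i^{n_i}/n_i! = f_N(A, γ, z)`. -/
theorem lhaf_master_trace_form (M : ℕ) (hM : 1 ≤ M)
    (A : Matrix (Fin M ⊕ Fin M) (Fin M ⊕ Fin M) ℂ) (hA : A.IsSymm)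
    (γ : Fin M ⊕ Fin M → ℂ) (z : Fin M → ℂ) (N : ℕ) :
    ∑ n ∈ (Fintype.piFinset fun _ : Fin M => Finset.range (N + 1)).filter
        (fun n => ∑ i, n i = N),
      lhafv (repMat A n n) (repVec γ n n) * ∏ i, z i ^ n i / (n i).factorial
      = fN N A γ z := by
  have h := coeff_eq_KK A hA γ z N []
  rw [LL_nil, mul_one, ← fN_eq] at h
  rw [h]
  unfold KK PP
  refine Finset.sum_congr rfl fun n _ => ?_
  rw [List.append_nil, ← ofFn_dbl, ← lhafv_eq_LL]
  rfl

end
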